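/- Let X, X̂ ∈ ℂ^{nd×d} be block matrices whose n blocks of size d×d are unitary matrices, and let X̃ ∈ ℂ^{nd×d} satisfy X̃*X̃ = I_d. Write X̃_i ∈ ℂ^{d×d} for the i-th block of X̃ and X̂_i for the i-th block of X̂, and set D_i = ‖X̂_i − √n·X̃_i‖_F. Then ‖(1/n)XX* − (1/n)X̂X̂*‖_F² ≤ 2·‖(1/n)XX* − X̃X̃*‖_F² + (4(d+1)/n)·Σ_{i=1}^{n} D_i². -/

import Mathlib

open MeasureTheory ProbabilityTheory Matrix Filter Topology
open scoped ENNReal NNReal ComplexOrder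

noncomputable section

namespace GroupSync

/-- The law of a standard real Gaussian (mean `0`, variance `1`), viewed on `ℂ`. -/
def stdRealGaussC : Measure ℂ :=
  (ProbabilityTheory.gaussianReal 0 1).map (fun x : ℝ => (x : ℂ))

/-- The law of a standard complex Gaussian (mean `0`, absolute second moment `1`). -/
def stdCplxGaussC : Measure ℂ :=
  ((ProbabilityTheory.gaussianReal 0 (1/2)).prod
    (ProbabilityTheory.gaussianReal 0 (1/2))).map
    (fun p : ℝ × ℝ => (p.1 : ℂ) + (p.2 : ℂ) * Complex.I)

/-- A unitary representation is irreducible iff it has no nontrivial invariant subspace. -/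
def IrreducibleRep {G : Type*} [Group G] {d : ℕ}
    (π : G →* Matrix.unitaryGroup (Fin d) ℂ) : Prop :=
  ∀ V : Submodule ℂ (Fin d → ℂ),
    (∀ g : G, ∀ v ∈ V, Matrix.mulVec (π g : Matrix (Fin d) (Fin d) ℂ) v ∈ V) →
    V = ⊥ ∨ V = ⊤

/-- A representation is nontrivial if some group element is not mapped to the identity. -/
def NontrivialRep {G : Type*} [Group G] {d : ℕ}
    (π : G →* Matrix.unitaryGroup (Fin d) ℂ) : Prop :=
  ∃ g : G, (π g : Matrix (Fin d) (Fin d) ℂ) ≠ 1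

/-- Squared Frobenius norm of a complex matrix. -/
def frobSq {m p : Type*} [Fintype m] [Fintype p] (A : Matrix m p ℂ) : ℝ :=
  ∑ i, ∑ j, ‖A i j‖ ^ 2

/-- Eigenvalues of a Hermitian matrix (junk value `0` if the matrix is not Hermitian). -/
def herEigs {m : Type*} [Fintype m] [DecidableEq m] (A : Matrix m m ℂ) : m → ℝ :=
  if h : A.IsHermitian then h.eigenvalues else fun _ => 0

/-- `eigDescNat A k` is `λ_{k+1}`, the `(k+1)`-st largest eigenvalue of the Hermitian matrix
`A` (counted with multiplicity); junk value `0` if `k` is out of range. -/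
def eigDescNat {m : Type*} [Fintype m] [DecidableEq m] (A : Matrix m m ℂ) (k : ℕ) : ℝ :=
  if h : k < Fintype.card m then
    (fun i => herEigs A ((Fintype.equivFin m).symm i))
      (Tuple.sort (fun i => herEigs A ((Fintype.equivFin m).symm i)) (Fin.rev ⟨k, h⟩))
  else 0

/-- Largest eigenvalue of a Hermitian matrix. -/
def eigMax {m : Type*} [Fintype m] [DecidableEq m] (A : Matrix m m ℂ) : ℝ :=
  ⨆ i, herEigs A i

/-- Smallest eigenvalue of a Hermitian matrix. -/
def eigMin {m : Type*} [Fintype m] [DecidableEq m] (A : Matrix m m ℂ) : ℝ :=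
  ⨅ i, herEigs A i

/-- The empirical spectral distribution of a Hermitian matrix. -/
def ESD {m : Type*} [Fintype m] [DecidableEq m] (A : Matrix m m ℂ) : Measure ℝ :=
  ((Fintype.card m : ℝ≥0∞))⁻¹ • ∑ i : m, Measure.dirac (herEigs A i)

/-- The Wigner semicircle law. -/
def semicircleLaw : Measure ℝ :=
  volume.withDensity fun x => ENNReal.ofReal (Real.sqrt (4 - x ^ 2) / (2 * Real.pi))

/-- Operator (spectral) norm of a square complex matrix, i.e. the norm of the induced
operator on Euclidean space. -/
def opNorm {m : Type*} [Fintype m] [DecidableEq m] (A : Matrix m m ℂ) : ℝ :=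
  ‖(Matrix.toEuclideanCLM (𝕜 := ℂ) A : EuclideanSpace ℂ m →L[ℂ] EuclideanSpace ℂ m)‖

/-- Index type enumerating the independent random ingredients of the synchronization model:
for each problem size `n` and each pair `i < j`, a Haar group element, the Gaussian entries of
the additive-noise block, the outlier mask `Δ`, and the edge mask `E`. -/
inductive NIdx (d : ℕ) : Type
  | haar (n i j : ℕ) (hij : i < j)
  | gauss (n i j : ℕ) (hij : i < j) (a b : Fin d)
  | mask (n i j : ℕ) (hij : i < j)
  | edge (n i j : ℕ) (hij : i < j)

/-- Target type of each random ingredient. -/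
def NIdx.T (G : Type) {d : ℕ} : NIdx d → Type
  | .haar _ _ _ _ => G
  | .gauss _ _ _ _ _ _ => ℂ
  | .mask _ _ _ _ => Bool
  | .edge _ _ _ _ => Bool

/-- Measurable-space structure on the target of each random ingredient. -/
def NIdx.ms (G : Type) [MeasurableSpace G] {d : ℕ} :
    ∀ k : NIdx d, MeasurableSpace (NIdx.T G k)
  | .haar _ _ _ _ => inferInstanceAs (MeasurableSpace G)
  | .gauss _ _ _ _ _ _ => inferInstanceAs (MeasurableSpace ℂ)
  | .mask _ _ _ _ => inferInstanceAs (MeasurableSpace Bool)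
  | .edge _ _ _ _ => inferInstanceAs (MeasurableSpace Bool)

/-- The combined family of random ingredients, as a dependent family indexed by `NIdx`. -/
def ingredients {G : Type} {Ω : Type*} {d : ℕ}
    (gm : ℕ → ℕ → ℕ → Ω → G) (ep : ℕ → ℕ → ℕ → Fin d → Fin d → Ω → ℂ)
    (dl ed : ℕ → ℕ → ℕ → Ω → Bool) : ∀ k : NIdx d, Ω → NIdx.T G k
  | .haar n i j _ => gm n i j
  | .gauss n i j _ a b => ep n i j a b
  | .mask n i j _ => dl n i j
  | .edge n i j _ => ed n i j

/-- `0/1`-valued indicator of a Boolean, in `ℂ`. -/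
def indC (b : Bool) : ℂ := if b then 1 else 0

variable {G Ω : Type*} [Group G]

/-- The raw pure-noise matrix `E ⊙ (Δ̄ ⊙ Π + (σ/√d) ℰ)`: Hermitian, with zero diagonal
blocks; the block at `(i,j)`, `i < j`, is present when the edge mask is on, and consists of
the Haar block `π(g_{ij})` (when the `Δ` mask is off) plus the scaled Gaussian block. -/
def rawNoise {d : ℕ} (π : G →* Matrix.unitaryGroup (Fin d) ℂ)
    (gm : ℕ → ℕ → ℕ → Ω → G) (ep : ℕ → ℕ → ℕ → Fin d → Fin d → Ω → ℂ)
    (dl ed : ℕ → ℕ → ℕ → Ω → Bool) (σn : ℝ) (n : ℕ) (ω : Ω) :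
    Matrix (Fin n × Fin d) (Fin n × Fin d) ℂ :=
  Matrix.of fun s t =>
    if (s.1 : ℕ) = (t.1 : ℕ) then 0
    else if (s.1 : ℕ) < (t.1 : ℕ) then
      indC (ed n (s.1 : ℕ) (t.1 : ℕ) ω) *
        ((if dl n (s.1 : ℕ) (t.1 : ℕ) ω then 0
          else (π (gm n (s.1 : ℕ) (t.1 : ℕ) ω) : Matrix (Fin d) (Fin d) ℂ) s.2 t.2)
          + ((σn / Real.sqrt d : ℝ) : ℂ) * ep n (s.1 : ℕ) (t.1 : ℕ) s.2 t.2 ω)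
    else
      star (indC (ed n (t.1 : ℕ) (s.1 : ℕ) ω) *
        ((if dl n (t.1 : ℕ) (s.1 : ℕ) ω then 0
          else (π (gm n (t.1 : ℕ) (s.1 : ℕ) ω) : Matrix (Fin d) (Fin d) ℂ) t.2 s.2)
          + ((σn / Real.sqrt d : ℝ) : ℂ) * ep n (t.1 : ℕ) (s.1 : ℕ) t.2 s.2 ω))

/-- The normalized pure-noise matrix `𝒲 = (1/(τ √n)) E ⊙ (Δ̄ ⊙ Π + (σ/√d) ℰ)`. -/
def noiseMat {d : ℕ} (π : G →* Matrix.unitaryGroup (Fin d) ℂ)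
    (gm : ℕ → ℕ → ℕ → Ω → G) (ep : ℕ → ℕ → ℕ → Fin d → Fin d → Ω → ℂ)
    (dl ed : ℕ → ℕ → ℕ → Ω → Bool) (σn τn : ℝ) (n : ℕ) (ω : Ω) :
    Matrix (Fin n × Fin d) (Fin n × Fin d) ℂ :=
  (((τn * Real.sqrt n : ℝ) : ℂ))⁻¹ • rawNoise π gm ep dl ed σn n ω

/-- The signal block matrix `X` whose `i`-th `d×d` block is `π(g_i)`. -/
def sigMat {d : ℕ} (π : G →* Matrix.unitaryGroup (Fin d) ℂ) (ge : ℕ → ℕ → G) (n : ℕ) :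
    Matrix (Fin n × Fin d) (Fin d) ℂ :=
  Matrix.of fun s b => (π (ge n (s.1 : ℕ)) : Matrix (Fin d) (Fin d) ℂ) s.2 b

/-- The measurement matrix `Y`: identity diagonal blocks; for an edge `i < j`, the block is
`π(g_i g_j⁻¹) + ε_{ij}` (good link) or `π(g_{ij}) + ε_{ij}` (outlier); zero blocks off the
measurement graph; Hermitian below the diagonal. -/
def measMat {d : ℕ} (π : G →* Matrix.unitaryGroup (Fin d) ℂ) (ge : ℕ → ℕ → G)
    (gm : ℕ → ℕ → ℕ → Ω → G) (ep : ℕ → ℕ → ℕ → Fin d → Fin d → Ω → ℂ)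
    (dl ed : ℕ → ℕ → ℕ → Ω → Bool) (σn : ℝ) (n : ℕ) (ω : Ω) :
    Matrix (Fin n × Fin d) (Fin n × Fin d) ℂ :=
  Matrix.of fun s t =>
    if (s.1 : ℕ) = (t.1 : ℕ) then (if s.2 = t.2 then 1 else 0)
    else if (s.1 : ℕ) < (t.1 : ℕ) then
      indC (ed n (s.1 : ℕ) (t.1 : ℕ) ω) *
        ((if dl n (s.1 : ℕ) (t.1 : ℕ) ω
          then (π (ge n (s.1 : ℕ) * (ge n (t.1 : ℕ))⁻¹) : Matrix (Fin d) (Fin d) ℂ) s.2 t.2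
          else (π (gm n (s.1 : ℕ) (t.1 : ℕ) ω) : Matrix (Fin d) (Fin d) ℂ) s.2 t.2)
          + ((σn / Real.sqrt d : ℝ) : ℂ) * ep n (s.1 : ℕ) (t.1 : ℕ) s.2 t.2 ω)
    else
      star (indC (ed n (t.1 : ℕ) (s.1 : ℕ) ω) *
        ((if dl n (t.1 : ℕ) (s.1 : ℕ) ω
          then (π (ge n (t.1 : ℕ) * (ge n (s.1 : ℕ))⁻¹) : Matrix (Fin d) (Fin d) ℂ) t.2 s.2
          else (π (gm n (t.1 : ℕ) (s.1 : ℕ) ω) : Matrix (Fin d) (Fin d) ℂ) t.2 s.2)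
          + ((σn / Real.sqrt d : ℝ) : ℂ) * ep n (t.1 : ℕ) (s.1 : ℕ) t.2 s.2 ω))

/-- The MSE proxy `‖(1/n) X X* − X̃ X̃*‖_F²`. -/
def mseProxy {n d : ℕ} (X Xt : Matrix (Fin n × Fin d) (Fin d) ℂ) : ℝ :=
  frobSq (((n : ℂ))⁻¹ • (X * Xᴴ) - Xt * Xtᴴ)

end GroupSync

namespace GroupSync

/-- Matrices over a measurable space of entries, with the product σ-algebra. -/
instance matrixMeasurableSpace {m p α : Type*} [MeasurableSpace α] :
    MeasurableSpace (Matrix m p α) :=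
  inferInstanceAs (MeasurableSpace (m → p → α))

/-- Single-size variant of `NIdx`: independent ingredients for one fixed problem size. -/
inductive NIdx1 (d : ℕ) : Type
  | haar (i j : ℕ) (hij : i < j)
  | gauss (i j : ℕ) (hij : i < j) (a b : Fin d)
  | mask (i j : ℕ) (hij : i < j)
  | edge (i j : ℕ) (hij : i < j)

/-- Target type of each single-size random ingredient. -/
def NIdx1.T (G : Type) {d : ℕ} : NIdx1 d → Type
  | .haar _ _ _ => G
  | .gauss _ _ _ _ _ => ℂ
  | .mask _ _ _ => Bool
  | .edge _ _ _ => Bool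

/-- Measurable-space structure on the target of each single-size random ingredient. -/
def NIdx1.ms (G : Type) [MeasurableSpace G] {d : ℕ} :
    ∀ k : NIdx1 d, MeasurableSpace (NIdx1.T G k)
  | .haar _ _ _ => inferInstanceAs (MeasurableSpace G)
  | .gauss _ _ _ _ _ => inferInstanceAs (MeasurableSpace ℂ)
  | .mask _ _ _ => inferInstanceAs (MeasurableSpace Bool)
  | .edge _ _ _ => inferInstanceAs (MeasurableSpace Bool)

/-- The combined single-size family of random ingredients. -/
def ingredients1 {G : Type} {Ω : Type*} {d : ℕ}
    (gm : ℕ → ℕ → Ω → G) (ep : ℕ → ℕ → Fin d → Fin d → Ω → ℂ)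
    (dl ed : ℕ → ℕ → Ω → Bool) : ∀ k : NIdx1 d, Ω → NIdx1.T G k
  | .haar i j _ => gm i j
  | .gauss i j _ a b => ep i j a b
  | .mask i j _ => dl i j
  | .edge i j _ => ed i j

/-- The multiset of undirected edges of the closed walk `idx 0 → idx 1 → ⋯ → idx (2k-1) → idx 0`. -/
def walkEdges {n : ℕ} (k : ℕ) (idx : ℕ → Fin n) : Multiset (Sym2 (Fin n)) :=
  (Multiset.range (2 * k)).map fun l => s(idx l, idx ((l + 1) % (2 * k)))

/-- `M_{i₁,…,i_{2k}}`: the sum, over all choices of within-block coordinates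
`j : Fin (2k) → Fin d`, of the expectation of the product of the corresponding scalar
entries of the random matrix `W` along the closed walk `idx`. -/
def walkM {Ω : Type*} [MeasurableSpace Ω] (P : Measure Ω) {n d : ℕ}
    (W : Ω → Matrix (Fin n × Fin d) (Fin n × Fin d) ℂ) (k : ℕ) (idx : ℕ → Fin n) : ℂ :=
  if h : 0 < 2 * k then
    ∑ j : Fin (2 * k) → Fin d,
      ∫ ω, ∏ l ∈ Finset.range (2 * k),
        W ω (idx l, j ⟨l % (2 * k), Nat.mod_lt l h⟩)
            (idx ((l + 1) % (2 * k)), j ⟨(l + 1) % (2 * k), Nat.mod_lt (l + 1) h⟩) ∂P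
  else 0

/-- The symmetric `0/1` block-mask matrix `M` built from Bernoulli blocks: diagonal blocks
all-ones, the block at `(i,j)`, `i < j`, all-ones iff `bern n i j`. -/
def bMask {Ω : Type*} (bern : ℕ → ℕ → ℕ → Ω → Bool) (d n : ℕ) (ω : Ω) :
    Matrix (Fin n × Fin d) (Fin n × Fin d) ℂ :=
  Matrix.of fun s t =>
    if (s.1 : ℕ) = (t.1 : ℕ) then 1
    else if (s.1 : ℕ) < (t.1 : ℕ) then indC (bern n (s.1 : ℕ) (t.1 : ℕ) ω)
    else indC (bern n (t.1 : ℕ) (s.1 : ℕ) ω)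

/-- The `k`-th column of the scaled signal matrix `(1/√n) X`, where the `i`-th block of `X`
is `π(gᵢ)`. -/
def scaledCol {G : Type*} [Group G] {Ω : Type*} {d : ℕ}
    (π : G →* Matrix.unitaryGroup (Fin d) ℂ) (gi : ℕ → ℕ → Ω → G)
    (n : ℕ) (k : Fin d) (ω : Ω) : Fin n × Fin d → ℂ :=
  fun s => ((Real.sqrt n)⁻¹ : ℝ) * (π (gi n (s.1 : ℕ) ω) : Matrix (Fin d) (Fin d) ℂ) s.2 k

end GroupSync

open GroupSync

namespace GroupSync

theorem frobSq_nonneg {m p : Type*} [Fintype m] [Fintype p] (A : Matrix m p ℂ) :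
    0 ≤ frobSq A :=
  Finset.sum_nonneg fun _ _ => Finset.sum_nonneg fun _ _ => sq_nonneg _

theorem frobSq_smul {m p : Type*} [Fintype m] [Fintype p] (c : ℂ) (A : Matrix m p ℂ) :
    frobSq (c • A) = ‖c‖ ^ 2 * frobSq A := by
  simp [frobSq, mul_pow, Finset.mul_sum]

theorem frobSq_sub_comm {m p : Type*} [Fintype m] [Fintype p] (A B : Matrix m p ℂ) :
    frobSq (A - B) = frobSq (B - A) := by
  simp [frobSq, norm_sub_rev]

theorem frobSq_add_le {m p : Type*} [Fintype m] [Fintype p] (A B : Matrix m p ℂ) :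
    frobSq (A + B) ≤ 2 * frobSq A + 2 * frobSq B := by
  simp only [frobSq, Finset.mul_sum, ← Finset.sum_add_distrib]
  refine Finset.sum_le_sum fun i _ => Finset.sum_le_sum fun j _ => ?_
  have h := norm_add_le (A i j) (B i j)
  rw [Matrix.add_apply]
  nlinarith [norm_nonneg (A i j + B i j), sq_nonneg (‖A i j‖ - ‖B i j‖)]

theorem ofReal_frobSq {m p : Type*} [Fintype m] [Fintype p] (A : Matrix m p ℂ) :
    (frobSq A : ℂ) = (Aᴴ * A).trace := by
  simp only [frobSq, Matrix.trace, Matrix.diag_apply, Matrix.mul_apply,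
    Matrix.conjTranspose_apply, Complex.ofReal_sum]
  rw [Finset.sum_comm]
  refine Finset.sum_congr rfl fun i _ => Finset.sum_congr rfl fun j _ => ?_
  rw [RCLike.star_def, Complex.conj_mul', Complex.ofReal_pow]

/-- The Frobenius norm of a block matrix splits over its blocks. -/
theorem frobSq_eq_sum_blocks {ι a p : Type*} [Fintype ι] [Fintype a] [Fintype p]
    (A : Matrix (ι × a) p ℂ) :
    frobSq A = ∑ i, frobSq (Matrix.of fun x y => A (i, x) y) := by
  simp [frobSq, Fintype.sum_prod_type]

/-- The Gram matrix of a block matrix is the sum of the Gram matrices of its blocks. -/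
theorem conjTranspose_mul_self_eq_sum_blocks {ι a p : Type*} [Fintype ι] [Fintype a]
    (A : Matrix (ι × a) p ℂ) :
    Aᴴ * A = ∑ i, (Matrix.of fun x y => A (i, x) y)ᴴ * (Matrix.of fun x y => A (i, x) y) := by
  ext r s
  simp [Matrix.mul_apply, Matrix.sum_apply, Fintype.sum_prod_type]

/-- The projections onto the ranges of two isometries are at Frobenius distance at most `√2`
times that of the isometries. -/
theorem frobSq_projection_sub_le {m p : Type*} [Fintype m] [Fintype p] [DecidableEq p]
    (U V : Matrix m p ℂ) (hU : Uᴴ * U = 1) (hV : Vᴴ * V = 1) :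
    frobSq (U * Uᴴ - V * Vᴴ) ≤ 2 * frobSq (U - V) := by
  have key : frobSq (U * Uᴴ - V * Vᴴ) + 2 * frobSq (1 - Uᴴ * V) = 2 * frobSq (U - V) := by
    apply Complex.ofReal_injective
    push_cast
    simp only [ofReal_frobSq, Matrix.conjTranspose_sub, Matrix.conjTranspose_mul,
      Matrix.conjTranspose_conjTranspose, Matrix.conjTranspose_one, Matrix.sub_mul,
      Matrix.mul_sub, Matrix.trace_sub, Matrix.one_mul, Matrix.mul_one, hU, hV]
    have hUU : (U * Uᴴ * (U * Uᴴ)).trace = (1 : Matrix p p ℂ).trace := by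
      rw [Matrix.mul_assoc, ← Matrix.mul_assoc Uᴴ, hU, Matrix.one_mul, Matrix.trace_mul_comm, hU]
    have hVV : (V * Vᴴ * (V * Vᴴ)).trace = (1 : Matrix p p ℂ).trace := by
      rw [Matrix.mul_assoc, ← Matrix.mul_assoc Vᴴ, hV, Matrix.one_mul, Matrix.trace_mul_comm, hV]
    have hVU : (V * Vᴴ * (U * Uᴴ)).trace = (Vᴴ * U * (Uᴴ * V)).trace := by
      rw [Matrix.mul_assoc, Matrix.trace_mul_comm]
      simp only [Matrix.mul_assoc]
    have hUV : (U * Uᴴ * (V * Vᴴ)).trace = (Vᴴ * U * (Uᴴ * V)).trace := by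
      rw [Matrix.trace_mul_comm, hVU]
    rw [hUU, hVV, hVU, hUV]
    ring
  linarith [frobSq_nonneg (1 - Uᴴ * V)]

end GroupSync

/-- the block-wise rounding bound:
`MSE(X, X̂) ≤ 2·MSEproxy(X, X̃) + (4(d+1)/n)·Σᵢ Dᵢ²` where `Dᵢ = ‖X̂ᵢ − √n X̃ᵢ‖_F`. -/
theorem statement_14 (n d : ℕ) (X Xh Xt : Matrix (Fin n × Fin d) (Fin d) ℂ)
    (hX : ∀ i : Fin n, Matrix.of (fun a b => X (i, a) b) ∈ Matrix.unitaryGroup (Fin d) ℂ)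
    (hXh : ∀ i : Fin n, Matrix.of (fun a b => Xh (i, a) b) ∈ Matrix.unitaryGroup (Fin d) ℂ)
    (hXt : Xtᴴ * Xt = 1) :
    frobSq (((n : ℂ))⁻¹ • (X * Xᴴ) - ((n : ℂ))⁻¹ • (Xh * Xhᴴ)) ≤
      2 * frobSq (((n : ℂ))⁻¹ • (X * Xᴴ) - Xt * Xtᴴ) +
        (4 * (d + 1) / n) * ∑ i : Fin n,
          frobSq (Matrix.of (fun a b => Xh (i, a) b) -
            ((Real.sqrt n : ℝ) : ℂ) • Matrix.of (fun a b => Xt (i, a) b)) := by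
  rcases Nat.eq_zero_or_pos n with rfl | hn
  · simp [frobSq]
  have hnR : (0 : ℝ) < n := by exact_mod_cast hn
  have hs : 0 < Real.sqrt n := Real.sqrt_pos.2 hnR
  have hsq : ((Real.sqrt n : ℝ) : ℂ) * ((Real.sqrt n : ℝ) : ℂ) = n := by
    rw [← Complex.ofReal_mul, Real.mul_self_sqrt hnR.le, Complex.ofReal_natCast]
  set c : ℂ := ((Real.sqrt n : ℝ) : ℂ) with hc
  have hc0 : c ≠ 0 := Complex.ofReal_ne_zero.2 hs.ne'
  have hstar : star c⁻¹ = c⁻¹ := by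
    rw [star_inv₀, hc, RCLike.star_def, Complex.conj_ofReal]
  have hcc : c⁻¹ * c⁻¹ = (n : ℂ)⁻¹ := by rw [← mul_inv, hsq]
  have hgram : Xhᴴ * Xh = (n : ℂ) • (1 : Matrix (Fin d) (Fin d) ℂ) := by
    refine (conjTranspose_mul_self_eq_sum_blocks Xh).trans <|
      (Finset.sum_congr rfl fun i _ => Matrix.mem_unitaryGroup_iff'.1 (hXh i)).trans ?_
    simp [Nat.cast_smul_eq_nsmul]
  have hU : (c⁻¹ • Xh)ᴴ * (c⁻¹ • Xh) = 1 := by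
    rw [Matrix.conjTranspose_smul, hstar, Matrix.smul_mul, Matrix.mul_smul, smul_smul, hcc,
      hgram, smul_smul, inv_mul_cancel₀ (Nat.cast_ne_zero.2 hn.ne'), one_smul]
  have hproj : (n : ℂ)⁻¹ • (Xh * Xhᴴ) = (c⁻¹ • Xh) * (c⁻¹ • Xh)ᴴ := by
    rw [Matrix.conjTranspose_smul, hstar, Matrix.smul_mul, Matrix.mul_smul, smul_smul, hcc]
  have hdist : frobSq (c⁻¹ • Xh - Xt) = (n : ℝ)⁻¹ * frobSq (Xh - c • Xt) := by
    have h : c⁻¹ • Xh - Xt = c⁻¹ • (Xh - c • Xt) := by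
      rw [smul_sub, smul_smul, inv_mul_cancel₀ hc0, one_smul]
    rw [h, frobSq_smul, norm_inv, hc, Complex.norm_real, Real.norm_eq_abs, inv_pow, sq_abs,
      Real.sq_sqrt hnR.le]
  have hblocks : frobSq (Xh - c • Xt) = ∑ i : Fin n,
      frobSq (Matrix.of (fun a b => Xh (i, a) b) - c • Matrix.of (fun a b => Xt (i, a) b)) :=
    frobSq_eq_sum_blocks _
  rw [← hblocks, hproj]
  have h1 := frobSq_add_le ((n : ℂ)⁻¹ • (X * Xᴴ) - Xt * Xtᴴ)
    (Xt * Xtᴴ - (c⁻¹ • Xh) * (c⁻¹ • Xh)ᴴ)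
  rw [sub_add_sub_cancel, frobSq_sub_comm (Xt * Xtᴴ)] at h1
  have h2 := frobSq_projection_sub_le _ _ hU hXt
  rw [hdist] at h2
  have h3 : 4 * ((n : ℝ)⁻¹ * frobSq (Xh - c • Xt)) ≤
      4 * (d + 1) / n * frobSq (Xh - c • Xt) := by
    have h4 : 0 ≤ (n : ℝ)⁻¹ * frobSq (Xh - c • Xt) :=
      mul_nonneg (inv_nonneg.2 hnR.le) (frobSq_nonneg _)
    have h5 : 0 ≤ (d : ℝ) * ((n : ℝ)⁻¹ * frobSq (Xh - c • Xt)) :=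
      mul_nonneg d.cast_nonneg h4
    rw [div_eq_mul_inv]
    linarith
  linarith
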